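/- For every finite Markov decision process, every state-action pair (s,a) ∈ 𝒮×𝒜, and all positive integers k and d, the maximum over all (possibly non-stationary) deterministic policies of the expected number of visits to (s,a) within horizon k·d starting from state s is at most 6k times the maximum over all stationary policies of the expected number of visits to (s,a) within horizon d starting from s; that is, max_{π ∈ Π} W^π_{kd}(1_{s,a}, P, 1_s) ≤ 6k · max_{π ∈ Π_sta} W^π_d(1_{s,a}, P, 1_s). -/

import Mathlib

open scoped Classical BigOperators

/-- `val P r d π s` is the expected total reward `E[Σ_{h=1}^d r(s_h,a_h)]` collected in `d`
steps, following the (possibly non-stationary) deterministic policy `π` under the transition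
kernel `P`, starting from state `s`. -/
noncomputable def val {S A : Type*} [Fintype S] (P : S → A → S → ℝ)
    (r : S → A → ℝ) : ℕ → (ℕ → S → A) → S → ℝ
  | 0, _, _ => 0
  | d + 1, π, s =>
      r s (π 0 s) + ∑ s' : S, P s (π 0 s) s' * val P r d (fun h => π (h + 1)) s'

/-- The indicator reward `1_{s,a}`. -/
noncomputable def ind {S A : Type*} (s : S) (a : A) : S → A → ℝ :=
  fun s' a' => if s' = s ∧ a' = a then 1 else 0

lemma ind_nonneg {S A : Type*} (s : S) (a : A) (x : S) (b : A) : 0 ≤ ind s a x b := by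
  unfold ind; split_ifs <;> norm_num

section FiniteMDP

variable {S A : Type*} [Fintype S] {P : S → A → S → ℝ} {r : S → A → ℝ}

lemma sum_transition_mul_le (hP0 : ∀ s a s', 0 ≤ P s a s') (hP1 : ∀ s a, ∑ s' : S, P s a s' = 1)
    {f : S → ℝ} {C : ℝ} (hf : ∀ x, f x ≤ C) (x : S) (b : A) : ∑ y, P x b y * f y ≤ C :=
  calc ∑ y, P x b y * f y ≤ ∑ y, P x b y * C :=
        Finset.sum_le_sum fun y _ => mul_le_mul_of_nonneg_left (hf y) (hP0 x b y)
    _ = C := by rw [← Finset.sum_mul, hP1, one_mul]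

lemma sum_transition_mul_mono (hP0 : ∀ s a s', 0 ≤ P s a s') {f g : S → ℝ}
    (h : ∀ x, f x ≤ g x) (x : S) (b : A) : ∑ y, P x b y * f y ≤ ∑ y, P x b y * g y :=
  Finset.sum_le_sum fun y _ => mul_le_mul_of_nonneg_left (h y) (hP0 x b y)

lemma val_nonneg (hP0 : ∀ s a s', 0 ≤ P s a s') (hr : ∀ x b, 0 ≤ r x b) (n : ℕ)
    (π : ℕ → S → A) (x : S) : 0 ≤ val P r n π x := by
  induction n generalizing π x with
  | zero => simp [val]
  | succ n ih =>
    rw [val]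
    exact add_nonneg (hr _ _) (Finset.sum_nonneg fun y _ => mul_nonneg (hP0 _ _ _) (ih _ _))

lemma val_le_val_succ (hP0 : ∀ s a s', 0 ≤ P s a s') (hr : ∀ x b, 0 ≤ r x b) (n : ℕ)
    (π : ℕ → S → A) (x : S) : val P r n π x ≤ val P r (n + 1) π x := by
  induction n generalizing π x with
  | zero => exact val_nonneg hP0 hr 1 π x
  | succ n ih =>
    rw [val, val]
    gcongr with y
    · exact hP0 _ _ _
    · exact ih _ _

/-- If every policy collects at most `C` in `d` steps, then `d` more steps add at most `C`. -/
lemma val_add_le (hP0 : ∀ s a s', 0 ≤ P s a s') (hP1 : ∀ s a, ∑ s' : S, P s a s' = 1)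
    {d : ℕ} {C : ℝ} (hC : ∀ π x, val P r d π x ≤ C) (n : ℕ) (π : ℕ → S → A) (x : S) :
    val P r (n + d) π x ≤ val P r n π x + C := by
  induction n generalizing π x with
  | zero => simpa [val] using hC π x
  | succ n ih =>
    rw [Nat.succ_add, val, val]
    have h := sum_transition_mul_mono hP0 (ih fun h => π (h + 1)) x (π 0 x)
    simp only [mul_add, Finset.sum_add_distrib, ← Finset.sum_mul, hP1, one_mul] at h
    linarith

lemma val_mul_le (hP0 : ∀ s a s', 0 ≤ P s a s') (hP1 : ∀ s a, ∑ s' : S, P s a s' = 1)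
    {d : ℕ} {C : ℝ} (hC : ∀ π x, val P r d π x ≤ C) (k : ℕ) (π : ℕ → S → A) (x : S) :
    val P r (k * d) π x ≤ k * C := by
  induction k with
  | zero => simp [val]
  | succ k ih =>
    rw [Nat.succ_mul]
    push_cast
    linarith [val_add_le hP0 hP1 hC (k * d) π x]

/-- Under a stationary policy, starting from `s` maximises the expected number of visits to
`(s, a)`. -/
lemma val_ind_stationary_le (hP0 : ∀ s a s', 0 ≤ P s a s')
    (hP1 : ∀ s a, ∑ s' : S, P s a s' = 1) (s : S) (a : A) (σ : S → A) (n : ℕ) (x : S) :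
    val P (ind s a) n (fun _ => σ) x ≤ val P (ind s a) n (fun _ => σ) s := by
  induction n generalizing x with
  | zero => simp [val]
  | succ n ih =>
    by_cases hx : x = s
    · rw [hx]
    · have h0 : ind s a x (σ x) = 0 := by simp [ind, hx]
      calc val P (ind s a) (n + 1) (fun _ => σ) x
          = ∑ y, P x (σ x) y * val P (ind s a) n (fun _ => σ) y := by rw [val, h0, zero_add]
        _ ≤ val P (ind s a) n (fun _ => σ) s := sum_transition_mul_le hP0 hP1 ih x (σ x)
        _ ≤ _ := val_le_val_succ hP0 (ind_nonneg s a) n _ s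

/-- The discounted Bellman optimality equation has a solution, attained by a stationary policy. -/
lemma exists_bellman_solution [Fintype A] [Nonempty A] (hP0 : ∀ s a s', 0 ≤ P s a s')
    (hP1 : ∀ s a, ∑ s' : S, P s a s' = 1) (r : S → A → ℝ) {γ : ℝ} (hγ0 : 0 ≤ γ) (hγ1 : γ < 1) :
    ∃ (V : S → ℝ) (σ : S → A), (∀ x b, r x b + γ * ∑ y, P x b y * V y ≤ V x) ∧
      ∀ x, V x = r x (σ x) + γ * ∑ y, P x (σ x) y * V y := by
  let Q : (S → ℝ) → S → A → ℝ := fun V x b => r x b + γ * ∑ y, P x b y * V y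
  let T : (S → ℝ) → S → ℝ := fun V x => Finset.univ.sup' Finset.univ_nonempty (Q V x)
  have hT : ∀ U V x, T U x ≤ T V x + γ * dist U V := by
    intro U V x
    refine Finset.sup'_le _ _ fun b hb => ?_
    have h1 : Q V x b ≤ T V x := Finset.le_sup' (Q V x) hb
    have h2 : ∑ y, P x b y * (U y - V y) ≤ dist U V :=
      sum_transition_mul_le hP0 hP1
        (fun y => (le_abs_self _).trans (dist_le_pi_dist U V y)) x b
    simp only [mul_sub, Finset.sum_sub_distrib] at h2
    have h3 := mul_le_mul_of_nonneg_left h2 hγ0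
    simp only [Q] at h1 ⊢
    linarith
  have hc : ContractingWith ⟨γ, hγ0⟩ T := by
    refine ⟨hγ1, LipschitzWith.of_dist_le_mul fun U V => ?_⟩
    refine (dist_pi_le_iff (by positivity)).2 fun x => ?_
    rw [Real.dist_eq, abs_sub_le_iff]
    have h1 := hT U V x
    have h2 := hT V U x
    rw [dist_comm V U] at h2
    constructor <;> change _ ≤ γ * _ <;> linarith
  have hV : ∀ x, T (hc.fixedPoint T) x = hc.fixedPoint T x :=
    congrFun hc.fixedPoint_isFixedPt
  choose σ _ hσ using fun x =>
    Finset.exists_mem_eq_sup' Finset.univ_nonempty (Q (hc.fixedPoint T) x)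
  refine ⟨hc.fixedPoint T, σ, fun x b => ?_, fun x => (hV x).symm.trans (hσ x)⟩
  exact (Finset.le_sup' (Q (hc.fixedPoint T) x) (Finset.mem_univ b)).trans_eq (hV x)

/-- Finite-horizon values under any policy are dominated by a discounted supersolution. -/
lemma pow_mul_val_succ_le (hP0 : ∀ s a s', 0 ≤ P s a s') (hr : ∀ x b, 0 ≤ r x b)
    {γ : ℝ} (hγ0 : 0 ≤ γ) (hγ1 : γ ≤ 1) {V : S → ℝ} (hV0 : ∀ x, 0 ≤ V x)
    (hV : ∀ x b, r x b + γ * ∑ y, P x b y * V y ≤ V x) (n : ℕ)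
    (π : ℕ → S → A) (x : S) : γ ^ n * val P r (n + 1) π x ≤ V x := by
  induction n generalizing π x with
  | zero =>
    have h : 0 ≤ γ * ∑ y, P x (π 0 x) y * V y :=
      mul_nonneg hγ0 (Finset.sum_nonneg fun y _ => mul_nonneg (hP0 _ _ _) (hV0 y))
    simp only [val, pow_zero, one_mul, mul_zero, Finset.sum_const_zero, add_zero]
    linarith [hV x (π 0 x)]
  | succ n ih =>
    have h := sum_transition_mul_mono hP0 (ih fun h => π (h + 1)) x (π 0 x)
    simp only [mul_left_comm _ (γ ^ n), ← Finset.mul_sum] at h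
    have h1 := mul_le_mul_of_nonneg_left h hγ0
    have h2 := mul_le_of_le_one_left (hr x (π 0 x)) (pow_le_one₀ hγ0 hγ1 (n := n + 1))
    rw [← mul_assoc, ← pow_succ'] at h1
    rw [val, mul_add]
    linarith [hV x (π 0 x)]

/-- A solution of the discounted Bellman equation is nonnegative when the reward is. -/
lemma bellman_supersolution_nonneg [Nonempty A] (hP0 : ∀ s a s', 0 ≤ P s a s')
    (hP1 : ∀ s a, ∑ s' : S, P s a s' = 1) (hr : ∀ x b, 0 ≤ r x b) {γ : ℝ} (hγ0 : 0 ≤ γ)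
    (hγ1 : γ < 1) {V : S → ℝ} (hV : ∀ x b, r x b + γ * ∑ y, P x b y * V y ≤ V x) (x : S) :
    0 ≤ V x := by
  have : Nonempty S := ⟨x⟩
  obtain ⟨z, hz⟩ := Finite.exists_min V
  obtain ⟨b⟩ := ‹Nonempty A›
  have h1 : ∑ y, P z b y * V z ≤ ∑ y, P z b y * V y :=
    sum_transition_mul_mono hP0 hz z b
  rw [← Finset.sum_mul, hP1, one_mul] at h1
  have h2 := mul_le_mul_of_nonneg_left h1 hγ0
  have h3 : 0 ≤ V z := by nlinarith [hV z b, hr z b]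
  exact h3.trans (hz x)

/-- The discounted value of a stationary policy, truncated after `n` steps. -/
lemma le_val_add_pow_mul (hP0 : ∀ s a s', 0 ≤ P s a s') (hP1 : ∀ s a, ∑ s' : S, P s a s' = 1)
    (hr : ∀ x b, 0 ≤ r x b) {γ : ℝ} (hγ0 : 0 ≤ γ) (hγ1 : γ ≤ 1) {V : S → ℝ} {σ : S → A}
    (hV : ∀ x, V x = r x (σ x) + γ * ∑ y, P x (σ x) y * V y) {M : ℝ} (hM : ∀ x, V x ≤ M)
    (n : ℕ) (x : S) : V x ≤ val P r n (fun _ => σ) x + γ ^ n * M := by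
  induction n generalizing x with
  | zero => simpa [val] using hM x
  | succ n ih =>
    have h := sum_transition_mul_mono hP0 ih x (σ x)
    simp only [mul_add, Finset.sum_add_distrib, ← Finset.sum_mul, hP1, one_mul] at h
    have h0 : 0 ≤ ∑ y, P x (σ x) y * val P r n (fun _ => σ) y :=
      Finset.sum_nonneg fun y _ => mul_nonneg (hP0 _ _ _) (val_nonneg hP0 hr n _ y)
    have h1 := mul_le_mul_of_nonneg_left h hγ0
    have h2 := mul_le_of_le_one_left h0 hγ1
    rw [hV x, val, pow_succ', mul_assoc]
    linarith

end FiniteMDP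

/-- Approximation power of stationary policies: for all positive integers `k, d`, the maximal
expected number of visits to `(s,a)` within horizon `k·d` starting from `s`, over all
(possibly non-stationary) deterministic policies, is at most `6k` times the maximal expected
number of visits to `(s,a)` within horizon `d` starting from `s`, over stationary policies. -/
theorem stationary_approximation_power {S A : Type*} [Fintype S] [Fintype A] [Nonempty A]
    (P : S → A → S → ℝ)
    (hP0 : ∀ s a s', 0 ≤ P s a s') (hP1 : ∀ s a, ∑ s' : S, P s a s' = 1)
    (s : S) (a : A) (k d : ℕ) (hk : 1 ≤ k) (hd : 1 ≤ d) (π : ℕ → S → A) :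
    ∃ π' : S → A,
      val P (ind s a) (k * d) π s ≤ 6 * (k : ℝ) * val P (ind s a) d (fun _ => π') s := by
  have : Nonempty S := ⟨s⟩
  obtain ⟨n, rfl⟩ : ∃ n, d = n + 1 := ⟨d - 1, by omega⟩
  set γ : ℝ := Real.exp (-(1 / ((n + 1 : ℕ) : ℝ))) with hγ
  have hγ0 : 0 ≤ γ := (Real.exp_pos _).le
  have hγ1 : γ < 1 := Real.exp_lt_one_iff.2 (neg_lt_zero.2 (by positivity))
  have hpow : γ ^ (n + 1) = (Real.exp 1)⁻¹ := by
    rw [hγ, ← Real.exp_nat_mul, ← Real.exp_neg]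
    congr 1
    field_simp
  have he2 : (2 : ℝ) < Real.exp 1 := by linarith [Real.exp_one_gt_d9]
  have he3 : Real.exp 1 < 3 := by linarith [Real.exp_one_lt_d9]
  have hpow_le : γ ^ (n + 1) ≤ 1 / 2 := by
    rw [hpow, inv_eq_one_div]; gcongr
  have hpow_ge : 1 / 3 ≤ γ ^ n := by
    refine le_trans ?_ (pow_le_pow_of_le_one hγ0 hγ1.le n.le_succ)
    rw [Nat.succ_eq_add_one, hpow, inv_eq_one_div]; gcongr
  have hr := ind_nonneg s a
  obtain ⟨V, σ, hV, hσ⟩ := exists_bellman_solution hP0 hP1 (ind s a) hγ0 hγ1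
  have hV0 := bellman_supersolution_nonneg hP0 hP1 hr hγ0 hγ1 hV
  obtain ⟨z, hz⟩ := Finite.exists_max V
  have hblock : ∀ π x, val P (ind s a) (n + 1) π x ≤ 3 * V z := fun π x => by
    have h1 := (pow_mul_val_succ_le hP0 hr hγ0 hγ1.le hV0 hV n π x).trans (hz x)
    have h2 := mul_le_mul_of_nonneg_right hpow_ge (val_nonneg hP0 hr (n + 1) π x)
    linarith
  have hVz : V z ≤ 2 * val P (ind s a) (n + 1) (fun _ => σ) s := by
    have h1 := le_val_add_pow_mul hP0 hP1 hr hγ0 hγ1.le hσ hz (n + 1) z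
    have h2 := val_ind_stationary_le hP0 hP1 s a σ (n + 1) z
    have h3 := mul_le_mul_of_nonneg_right hpow_le (hV0 z)
    linarith
  refine ⟨σ, (val_mul_le hP0 hP1 hblock k π s).trans ?_⟩
  have h := mul_le_mul_of_nonneg_left hVz (Nat.cast_nonneg (α := ℝ) k)
  linarith
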